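/- arXiv:2310.09697 — 2 statements merged into one kernel-verified Lean document; each statement's English description precedes it below -/
import Mathlib

section
/- Let ν_1, ν_2 be Borel probability measures on ℝ^n with finite first moments and Y_1, Y_2 random vectors with these laws. For t ∈ [0,1] let Y_t have law (1-t)ν_1 + tν_2. Then the Vitale zonoid satisfies Z(Y_t) = (1-t)Z(Y_1) + tZ(Y_2) (Minkowski sum of dilates), and consequently t ↦ (E|det M_{Y_t}|)^{1/n} is concave on [0,1], where M_{Y_t} is the n×n matrix with n iid columns of law (1-t)ν_1 + tν_2. -/
open MeasureTheory Metric Set Filter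
open scoped RealInnerProductSpace NNReal ENNReal Pointwise Topology

/-- The support function of a set `A ⊆ ℝⁿ`: `h_A(ξ) = sup_{ζ ∈ A} ⟨ζ, ξ⟩`. -/
noncomputable def suppFn {n : ℕ} (A : Set (EuclideanSpace ℝ (Fin n)))
    (ξ : EuclideanSpace ℝ (Fin n)) : ℝ :=
  sSup ((fun ζ => ⟪ζ, ξ⟫) '' A)

/-- Recursive volume polynomial of an alternating form. -/
noncomputable def PP {ι V : Type*} [Fintype ι] [AddCommGroup V] [Module ℝ V]
    (y : ι → V) (x : ι → ℝ) : (m : ℕ) → (V [⋀^Fin m]→ₗ[ℝ] ℝ) → ℝ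
  | 0, ω => |ω 0|
  | m + 1, ω => ∑ i, x i * PP y x m (ω.curryLeft (y i))

section PPbasic
variable {ι V : Type*} [Fintype ι] [AddCommGroup V] [Module ℝ V]

theorem PP_succ (y : ι → V) (x : ι → ℝ) (m : ℕ) (ω : V [⋀^Fin (m + 1)]→ₗ[ℝ] ℝ) :
    PP y x (m + 1) ω = ∑ i, x i * PP y x m (ω.curryLeft (y i)) := rfl

theorem PP_zero_form (y : ι → V) (x : ι → ℝ) (m : ℕ) :
    PP y x m (0 : V [⋀^Fin m]→ₗ[ℝ] ℝ) = 0 := by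
  induction m with
  | zero => simp [PP]
  | succ m ih => simp [PP_succ, ih]

theorem PP_neg (y : ι → V) (x : ι → ℝ) (m : ℕ) (ω : V [⋀^Fin m]→ₗ[ℝ] ℝ) :
    PP y x m (-ω) = PP y x m ω := by
  induction m with
  | zero => simp [PP]
  | succ m ih =>
    rw [PP_succ, PP_succ]
    refine Finset.sum_congr rfl fun i _ => ?_
    have : (-ω).curryLeft (y i) = -(ω.curryLeft (y i)) := by
      ext v; simp
    rw [this, ih]

theorem curry_swap {m : ℕ} (ω : V [⋀^Fin (m + 2)]→ₗ[ℝ] ℝ) (a b : V) :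
    (ω.curryLeft a).curryLeft b = -((ω.curryLeft b).curryLeft a) := by
  have h := AlternatingMap.curryLeft_same ω (a + b)
  have h1 := AlternatingMap.curryLeft_same ω a
  have h2 := AlternatingMap.curryLeft_same ω b
  have hadd : ∀ (ψ φ : V [⋀^Fin (m + 1)]→ₗ[ℝ] ℝ), (ψ + φ).curryLeft = ψ.curryLeft + φ.curryLeft :=
    fun ψ φ => AlternatingMap.curryLeft_add ψ φ
  have h3 : ω.curryLeft (a + b) = ω.curryLeft a + ω.curryLeft b := map_add _ _ _
  rw [h3, hadd, LinearMap.add_apply, map_add, map_add, h1, h2] at h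
  rw [eq_neg_iff_add_eq_zero]
  simpa using h

theorem PP_swap (y : ι → V) (x : ι → ℝ) {m : ℕ} (ω : V [⋀^Fin (m + 2)]→ₗ[ℝ] ℝ) (a b : V) :
    PP y x m ((ω.curryLeft a).curryLeft b) = PP y x m ((ω.curryLeft b).curryLeft a) := by
  rw [curry_swap, PP_neg]

theorem PP_nonneg (y : ι → V) (x : ι → ℝ) (hx : ∀ i, 0 ≤ x i) (m : ℕ)
    (ω : V [⋀^Fin m]→ₗ[ℝ] ℝ) : 0 ≤ PP y x m ω := by
  induction m with
  | zero => exact abs_nonneg _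
  | succ m ih => exact Finset.sum_nonneg fun i _ => mul_nonneg (hx i) (ih _)

theorem PP_succ_eq_zero (y : ι → V) (x : ι → ℝ) (hx : ∀ i, 0 < x i) (m : ℕ)
    (ω : V [⋀^Fin (m + 1)]→ₗ[ℝ] ℝ) (h : PP y x (m + 1) ω = 0) (i : ι) :
    PP y x m (ω.curryLeft (y i)) = 0 := by
  rw [PP_succ, Finset.sum_eq_zero_iff_of_nonneg
    (fun i _ => mul_nonneg (hx i).le (PP_nonneg y x (fun i => (hx i).le) _ _))] at h
  have := h i (Finset.mem_univ i)
  exact (mul_eq_zero.mp this).resolve_left (hx i).ne'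

theorem PP_eq_zero_all (y : ι → V) (x : ι → ℝ) (hx : ∀ i, 0 < x i) (x' : ι → ℝ) (m : ℕ)
    (ω : V [⋀^Fin m]→ₗ[ℝ] ℝ) (h : PP y x m ω = 0) : PP y x' m ω = 0 := by
  induction m with
  | zero => exact h
  | succ m ih =>
    rw [PP_succ]
    exact Finset.sum_eq_zero fun i _ => by rw [ih _ (PP_succ_eq_zero y x hx m ω h i), mul_zero]

theorem form_zero_of_PP (y : ι → V) (x : ι → ℝ) (hx : ∀ i, 0 < x i)
    (hy : Submodule.span ℝ (Set.range y) = ⊤) (m : ℕ)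
    (ω : V [⋀^Fin m]→ₗ[ℝ] ℝ) (h : PP y x m ω = 0) : ω = 0 := by
  induction m with
  | zero =>
    ext v
    have : v = 0 := Subsingleton.elim _ _
    subst this
    simpa [PP] using h
  | succ m ih =>
    have h0 : ω.curryLeft = 0 := by
      apply LinearMap.ext_on_range hy
      intro i
      exact ih _ (PP_succ_eq_zero y x hx m ω h i)
    ext v
    have := congrArg (fun f => f (v 0) (fun i => v i.succ)) h0
    simp only [AlternatingMap.curryLeft_apply_apply, LinearMap.zero_apply,
      AlternatingMap.zero_apply] at this
    rw [AlternatingMap.zero_apply, ← this]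
    congr 1
    ext i
    refine Fin.cases ?_ (fun j => ?_) i <;> simp

theorem PP_comp {W : Type*} [AddCommGroup W] [Module ℝ W] (f : V →ₗ[ℝ] W)
    (y : ι → V) (x : ι → ℝ) (m : ℕ) (ω : W [⋀^Fin m]→ₗ[ℝ] ℝ) :
    PP y x m (ω.compLinearMap f) = PP (fun i => f (y i)) x m ω := by
  induction m with
  | zero =>
    simp only [PP, AlternatingMap.compLinearMap_apply]
    congr 2
    exact Subsingleton.elim _ _
  | succ m ih =>
    rw [PP_succ, PP_succ]
    refine Finset.sum_congr rfl fun i _ => ?_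
    rw [← ih, AlternatingMap.curryLeft_compLinearMap]

theorem PP_eq_sum (y : ι → V) (x : ι → ℝ) (m : ℕ) (ω : V [⋀^Fin m]→ₗ[ℝ] ℝ) :
    PP y x m ω = ∑ i : Fin m → ι, (∏ k, x (i k)) * |ω (fun k => y (i k))| := by
  induction m with
  | zero =>
    simp only [PP, Finset.univ_unique, Finset.univ_eq_empty, Finset.prod_empty, one_mul,
      Finset.sum_singleton]
    congr 2
    exact Subsingleton.elim _ _
  | succ m ih =>
    rw [PP_succ, ← (Fin.consEquiv (fun _ : Fin (m + 1) => ι)).sum_comp, Fintype.sum_prod_type]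
    refine Finset.sum_congr rfl fun i _ => ?_
    rw [ih, Finset.mul_sum]
    refine Finset.sum_congr rfl fun j _ => ?_
    rw [Fin.prod_univ_succ]
    simp only [Fin.consEquiv_apply, Fin.cons_zero, Fin.cons_succ,
      AlternatingMap.curryLeft_apply_apply, mul_assoc]
    congr 4
    ext k
    refine Fin.cases ?_ (fun l => ?_) k <;> simp

theorem PP_hasDerivAt (y : ι → V) (x d : ι → ℝ) (m : ℕ) (ω : V [⋀^Fin m]→ₗ[ℝ] ℝ) (t : ℝ) :
    HasDerivAt (fun s => PP y (fun i => x i + s * d i) m ω)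
      (match m, ω with
        | 0, _ => 0
        | m + 1, ω => (m + 1 : ℝ) *
            ∑ i, d i * PP y (fun i => x i + t * d i) m (ω.curryLeft (y i))) t := by
  induction m with
  | zero => exact hasDerivAt_const _ _
  | succ m ih =>
    simp only [PP_succ]
    have h1 : ∀ i, HasDerivAt (fun s => (x i + s * d i)) (d i) t := fun i => by
      simpa using ((hasDerivAt_id t).mul_const (d i)).const_add (x i)
    have h2 := HasDerivAt.fun_sum (u := Finset.univ)
      (fun i _ => (h1 i).mul (ih (ω.curryLeft (y i))))
    refine h2.congr_deriv ?_
    rw [Finset.sum_add_distrib]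
    cases m with
    | zero => simp
    | succ m =>
      simp only
      have : ∑ i, (x i + t * d i) * ((m + 1 : ℝ) * ∑ j, d j * PP y (fun i => x i + t * d i) m
          ((ω.curryLeft (y i)).curryLeft (y j))) =
          (m + 1 : ℝ) * ∑ i, d i * PP y (fun i => x i + t * d i) (m + 1) (ω.curryLeft (y i)) := by
        simp only [PP_succ, Finset.mul_sum]
        rw [Finset.sum_comm]
        refine Finset.sum_congr rfl fun i _ => Finset.sum_congr rfl fun j _ => ?_
        rw [PP_swap]; ring
      rw [this]; push_cast; ring

end PPbasic

/-- Reverse Cauchy-Schwarz from negativity on a hyperplane direction. -/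
theorem disc_aux (B11 B12 B22 c : ℝ) (hB : 0 < B22)
    (h : B11 - 2 * c * B12 + c ^ 2 * B22 ≤ 0) : B11 * B22 ≤ B12 ^ 2 := by
  nlinarith [sq_nonneg (B12 - c * B22)]

theorem quad_expand {ι : Type*} [Fintype ι] (H : ι → ι → ℝ) (hs : ∀ i j, H i j = H j i)
    (v x : ι → ℝ) (c : ℝ) :
    ∑ i, (v i - c * x i) * ∑ j, H i j * (v j - c * x j) =
      ∑ i, v i * ∑ j, H i j * v j - 2 * c * ∑ i, v i * ∑ j, H i j * x j
        + c ^ 2 * ∑ i, x i * ∑ j, H i j * x j := by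
  have e : ∑ i, x i * ∑ j, H i j * v j = ∑ i, v i * ∑ j, H i j * x j := by
    simp only [Finset.mul_sum]
    rw [Finset.sum_comm]
    refine Finset.sum_congr rfl fun i _ => Finset.sum_congr rfl fun j _ => ?_
    rw [hs]; ring
  have e2 : ∑ i, (v i - c * x i) * ∑ j, H i j * (v j - c * x j) =
      ∑ i, v i * ∑ j, H i j * v j - c * ∑ i, v i * ∑ j, H i j * x j
      - c * ∑ i, x i * ∑ j, H i j * v j
        + c ^ 2 * ∑ i, x i * ∑ j, H i j * x j := by
    simp only [Finset.mul_sum, ← Finset.sum_sub_distrib, ← Finset.sum_add_distrib]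
    refine Finset.sum_congr rfl fun i _ => Finset.sum_congr rfl fun j _ => ?_
    ring
  rw [e2, e]; ring

theorem neg_of_eigen {ι : Type*} [Fintype ι] [DecidableEq ι] (M : Matrix ι ι ℝ)
    (hM : M.IsHermitian) (w : ι → ℝ)
    (h : ∀ (lam : ℝ) (e : ι → ℝ), 0 < lam → (∀ i, ∑ j, M i j * e j = lam * e i) →
      ∑ i, w i * e i = 0) :
    ∑ i, w i * ∑ j, M i j * w j ≤ 0 := by
  set b := hM.eigenvectorBasis with hb
  set W : EuclideanSpace ℝ ι := WithLp.toLp 2 w with hW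
  have key : ∀ k, ∑ i, (∑ j, M i j * w j) * b k i = hM.eigenvalues k * ⟪b k, W⟫ := by
    intro k
    have h1 := hM.mulVec_eigenvectorBasis k
    have h2 : ∀ i, ∑ j, M i j * b k j = hM.eigenvalues k * b k i := by
      intro i
      have := congrFun h1 i
      simpa [Matrix.mulVec, dotProduct] using this
    have h3 : ⟪b k, W⟫ = ∑ i, w i * b k i := by
      simp [PiLp.inner_apply, hW]
    rw [h3, Finset.mul_sum]
    simp only [Finset.sum_mul]
    rw [Finset.sum_comm]
    refine Finset.sum_congr rfl fun j _ => ?_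
    have : ∀ i, M i j * w j * b k i = w j * (M j i * b k i) := by
      intro i
      have := hM.apply i j
      simp at this
      rw [← this]; ring
    simp only [this]
    rw [← Finset.mul_sum, h2]; ring
  set MW : EuclideanSpace ℝ ι := WithLp.toLp 2 (fun i => ∑ j, M i j * w j) with hMW
  have e1 : ∑ i, w i * ∑ j, M i j * w j = ⟪W, MW⟫ := by
    simp [PiLp.inner_apply, hW, hMW, mul_comm]
  have e2 : ⟪W, MW⟫ = ∑ k, ⟪W, b k⟫ * ⟪b k, MW⟫ := (b.sum_inner_mul_inner W MW).symm
  rw [e1, e2]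
  refine Finset.sum_nonpos fun k _ => ?_
  have e3 : ⟪b k, MW⟫ = hM.eigenvalues k * ⟪b k, W⟫ := by
    rw [← key]; simp [PiLp.inner_apply, hMW]
  rw [e3, real_inner_comm (b k) W]
  rcases le_or_gt (hM.eigenvalues k) 0 with hl | hl
  · nlinarith [mul_nonneg (neg_nonneg.mpr hl) (mul_self_nonneg ⟪b k, W⟫)]
  · have h0 := h (hM.eigenvalues k) (fun i => b k i) hl (by
      intro i
      have := congrFun (hM.mulVec_eigenvectorBasis k) i
      simpa [Matrix.mulVec, dotProduct] using this)
    have : ⟪b k, W⟫ = 0 := by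
      rw [← h0]; simp [PiLp.inner_apply, hW]
    simp [this]

theorem hyperbolic_of_bochner {ι : Type*} [Fintype ι] (H : ι → ι → ℝ)
    (hs : ∀ i j, H i j = H j i) (hH : ∀ i j, 0 ≤ H i j) (x : ι → ℝ) (hx : ∀ i, 0 < x i)
    (ha : ∀ v : ι → ℝ, ∑ i, v i * ∑ j, H i j * v j ≤
      ∑ i, x i * (∑ j, H i j * v j) ^ 2 / (∑ j, H i j * x j))
    (hb : ∀ r : ι → ℝ, (∀ i j, H i j ≠ 0 → r i = r j) →
      ∃ c, ∀ i, (∑ j, H i j * x j) ≠ 0 → r i = c) (v : ι → ℝ) :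
    (∑ i, v i * ∑ j, H i j * v j) * (∑ i, x i * ∑ j, H i j * x j) ≤
      (∑ i, v i * ∑ j, H i j * x j) ^ 2 := by
  classical
  set p : ι → ℝ := fun i => ∑ j, H i j * x j with hp
  have hp0 : ∀ i, 0 ≤ p i := fun i =>
    Finset.sum_nonneg fun j _ => mul_nonneg (hH i j) (hx j).le
  have hrow : ∀ i, p i = 0 → ∀ j, H i j = 0 := by
    intro i hi j
    rw [hp] at hi
    simp only at hi
    rw [Finset.sum_eq_zero_iff_of_nonneg (fun j _ => mul_nonneg (hH i j) (hx j).le)] at hi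
    exact (mul_eq_zero.mp (hi j (Finset.mem_univ j))).resolve_right (hx j).ne'
  have hcol : ∀ i, p i = 0 → ∀ j, H j i = 0 := fun i hi j => by rw [hs]; exact hrow i hi j
  -- the total
  have hT0 : 0 ≤ ∑ i, x i * p i := Finset.sum_nonneg fun i _ => mul_nonneg (hx i).le (hp0 i)
  rcases hT0.eq_or_lt with hT | hT
  · rw [← hT, mul_zero]; positivity
  -- scaling
  set s : ι → ℝ := fun i => Real.sqrt (x i / p i) with hsdef
  have hs2 : ∀ i, s i ^ 2 = x i / p i := fun i =>
    Real.sq_sqrt (div_nonneg (hx i).le (hp0 i))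
  have hspos : ∀ i, p i ≠ 0 → 0 < s i := fun i hi =>
    Real.sqrt_pos.mpr (div_pos (hx i) (lt_of_le_of_ne (hp0 i) (Ne.symm hi)))
  have hs0 : ∀ i, p i = 0 → s i = 0 := fun i hi => by simp [hsdef, hi]
  set M : Matrix ι ι ℝ := Matrix.of fun i j => s i * H i j * s j with hMdef
  have hM : M.IsHermitian := by
    ext i j
    simp [hMdef, hs i j]; ring
  -- negativity on the hyperplane
  have hneg : ∀ z : ι → ℝ, ∑ i, z i * p i = 0 → ∑ i, z i * ∑ j, H i j * z j ≤ 0 := by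
    intro z hz
    have h1 := neg_of_eigen M hM (fun i => z i / s i) ?_
    · refine le_of_eq_of_le ?_ h1
      refine Finset.sum_congr rfl fun i _ => ?_
      rw [Finset.mul_sum, Finset.mul_sum]
      refine Finset.sum_congr rfl fun j _ => ?_
      simp only [hMdef, Matrix.of_apply]
      by_cases hi : p i = 0
      · simp [hrow i hi j]
      by_cases hj : p j = 0
      · simp [hcol j hj i]
      have := hspos i hi; have := hspos j hj
      field_simp
    · intro lam e hlam he
      have he' : ∀ i, s i * ∑ j, H i j * (s j * e j) = lam * e i := by
        intro i
        rw [← he i, Finset.mul_sum]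
        refine Finset.sum_congr rfl fun j _ => ?_
        simp only [hMdef, Matrix.of_apply]; ring
      have he0 : ∀ i, p i = 0 → e i = 0 := by
        intro i hi
        have := he' i
        rw [hs0 i hi, zero_mul] at this
        exact (mul_eq_zero.mp this.symm).resolve_left hlam.ne'
      set u : ι → ℝ := fun i => s i * e i with hu
      have hq : ∑ i, u i * ∑ j, H i j * u j = lam * ∑ i, e i ^ 2 := by
        rw [Finset.mul_sum]
        refine Finset.sum_congr rfl fun i _ => ?_
        have := he' i
        calc u i * ∑ j, H i j * u j = e i * (s i * ∑ j, H i j * (s j * e j)) := by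
              simp only [hu]; ring
          _ = _ := by rw [this]; ring
      have hq2 : ∑ i, x i * (∑ j, H i j * u j) ^ 2 / p i = lam ^ 2 * ∑ i, e i ^ 2 := by
        rw [Finset.mul_sum]
        refine Finset.sum_congr rfl fun i _ => ?_
        have := he' i
        calc x i * (∑ j, H i j * u j) ^ 2 / p i = (x i / p i) * (∑ j, H i j * u j) ^ 2 := by ring
          _ = (s i * ∑ j, H i j * (s j * e j)) ^ 2 := by rw [← hs2]; simp only [hu]; ring
          _ = _ := by rw [this]; ring
      have hA := ha u
      rw [hq, hq2] at hA
      have hE0 : 0 ≤ ∑ i, e i ^ 2 := Finset.sum_nonneg fun i _ => sq_nonneg _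
      rcases hE0.eq_or_lt with hE | hE
      · have : ∀ i, e i = 0 := by
          intro i
          have := (Finset.sum_eq_zero_iff_of_nonneg (fun i _ => sq_nonneg (e i))).mp hE.symm i
            (Finset.mem_univ i)
          exact pow_eq_zero_iff (two_ne_zero) |>.mp this
        simp [this]
      have hlam1 : 1 ≤ lam := by
        have : lam * ∑ i, e i ^ 2 ≤ lam * (lam * ∑ i, e i ^ 2) := by
          calc _ ≤ _ := hA
            _ = _ := by ring
        have := le_of_mul_le_mul_left this hlam
        nlinarith
      set r : ι → ℝ := fun i => u i / x i with hr
      have hur : ∀ i, u i = r i * x i := fun i => by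
        rw [hr]; simp only; rw [div_mul_cancel₀ _ (hx i).ne']
      have hpe : ∀ i, p i * x i * r i ^ 2 = e i ^ 2 := by
        intro i
        by_cases hi : p i = 0
        · simp [hi, he0 i hi]
        · have h1 : r i ^ 2 = x i / p i * e i ^ 2 / x i ^ 2 := by
            rw [← hs2]; simp only [hr, hu]; ring
          rw [h1]
          have := (hx i).ne'
          field_simp
      have hPF : ∑ i, ∑ j, H i j * x i * x j * (r i - r j) ^ 2 =
          2 * (1 - lam) * ∑ i, e i ^ 2 := by
        have t1 : ∑ i, ∑ j, H i j * x i * x j * r i ^ 2 = ∑ i, e i ^ 2 := by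
          refine Finset.sum_congr rfl fun i _ => ?_
          rw [← hpe i]
          simp only [hp, Finset.sum_mul]
          refine Finset.sum_congr rfl fun j _ => ?_
          ring
        have t2 : ∑ i, ∑ j, H i j * x i * x j * r j ^ 2 = ∑ i, e i ^ 2 := by
          rw [← t1, Finset.sum_comm]
          refine Finset.sum_congr rfl fun i _ => Finset.sum_congr rfl fun j _ => ?_
          rw [hs]; ring
        have t3 : ∑ i, ∑ j, H i j * x i * x j * (r i * r j) = lam * ∑ i, e i ^ 2 := by
          rw [← hq]
          refine Finset.sum_congr rfl fun i _ => ?_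
          rw [Finset.mul_sum]
          refine Finset.sum_congr rfl fun j _ => ?_
          rw [hur i, hur j]; ring
        have : ∑ i, ∑ j, H i j * x i * x j * (r i - r j) ^ 2 =
            ∑ i, ∑ j, H i j * x i * x j * r i ^ 2 + ∑ i, ∑ j, H i j * x i * x j * r j ^ 2
            - 2 * ∑ i, ∑ j, H i j * x i * x j * (r i * r j) := by
          simp only [Finset.mul_sum, ← Finset.sum_sub_distrib, ← Finset.sum_add_distrib]
          refine Finset.sum_congr rfl fun i _ => Finset.sum_congr rfl fun j _ => ?_
          ring
        rw [this, t1, t2, t3]; ring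
      have hterm : ∀ i j, 0 ≤ H i j * x i * x j * (r i - r j) ^ 2 := fun i j =>
        mul_nonneg (mul_nonneg (mul_nonneg (hH i j) (hx i).le) (hx j).le) (sq_nonneg _)
      have hsum0 : ∑ i, ∑ j, H i j * x i * x j * (r i - r j) ^ 2 = 0 := by
        apply le_antisymm
        · rw [hPF]; nlinarith
        · exact Finset.sum_nonneg fun i _ => Finset.sum_nonneg fun j _ => hterm i j
      have hreq : ∀ i j, H i j ≠ 0 → r i = r j := by
        intro i j hij
        rw [Finset.sum_eq_zero_iff_of_nonneg
          (fun i _ => Finset.sum_nonneg fun j _ => hterm i j)] at hsum0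
        have h1 := hsum0 i (Finset.mem_univ i)
        rw [Finset.sum_eq_zero_iff_of_nonneg (fun j _ => hterm i j)] at h1
        have h2 := h1 j (Finset.mem_univ j)
        have h3 : H i j * x i * x j ≠ 0 := mul_ne_zero (mul_ne_zero hij (hx i).ne') (hx j).ne'
        have h4 := (mul_eq_zero.mp h2).resolve_left h3
        exact sub_eq_zero.mp (pow_eq_zero_iff two_ne_zero |>.mp h4)
      obtain ⟨c, hc⟩ := hb r hreq
      have : ∑ i, z i / s i * e i = c * ∑ i, z i * p i := by
        rw [Finset.mul_sum]
        refine Finset.sum_congr rfl fun i _ => ?_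
        by_cases hi : p i = 0
        · simp [hi, he0 i hi]
        · have h1 : u i = c * x i := by rw [hur, hc i hi]
          have h2 := hspos i hi
          have h3 : e i = c * x i / s i := by
            rw [eq_div_iff h2.ne', ← h1]; simp only [hu]; ring
          have h4 : z i / s i * e i = z i * c * x i / s i ^ 2 := by rw [h3]; field_simp
          rw [h4, hs2]
          have := (hx i).ne'
          field_simp
      rw [this, hz, mul_zero]
  -- conclusion
  set c : ℝ := (∑ i, v i * p i) / (∑ i, x i * p i) with hc
  have h1 := hneg (fun i => v i - c * x i) (by
    have : ∑ i, (v i - c * x i) * p i = ∑ i, v i * p i - c * ∑ i, x i * p i := by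
      rw [Finset.mul_sum, ← Finset.sum_sub_distrib]
      refine Finset.sum_congr rfl fun i _ => by ring
    rw [this, hc, div_mul_cancel₀ _ hT.ne', sub_self])
  rw [quad_expand H hs v x c] at h1
  exact disc_aux _ _ _ c hT h1

theorem abs_sub_eq_integral (R s t : ℝ) (hs : |s| ≤ R) (ht : |t| ≤ R) :
    |s - t| = ∫ τ in Set.Icc (-R) R,
      ((Set.Iio s).indicator (fun _ => (1 : ℝ)) τ - (Set.Iio t).indicator (fun _ => (1 : ℝ)) τ) ^ 2 := by
  wlog hst : s ≤ t generalizing s t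
  · rw [abs_sub_comm, this t s ht hs (le_of_not_ge hst)]
    congr 1; ext τ; ring
  have h1 : (fun τ => ((Set.Iio s).indicator (fun _ => (1 : ℝ)) τ
      - (Set.Iio t).indicator (fun _ => (1 : ℝ)) τ) ^ 2) = (Set.Ico s t).indicator (fun _ => (1 : ℝ)) := by
    ext τ
    simp only [Set.indicator, Set.mem_Iio, Set.mem_Ico]
    by_cases h1 : τ < s
    · have : τ < t := h1.trans_le hst
      simp [h1, this]
    · by_cases h2 : τ < t <;> simp [h1, h2, not_lt.mp h1]
  rw [h1, integral_indicator measurableSet_Ico, Measure.restrict_restrict measurableSet_Ico]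
  have : Set.Ico s t ∩ Set.Icc (-R) R = Set.Ico s t := by
    apply Set.inter_eq_left.mpr
    intro τ hτ
    exact ⟨(neg_le_of_abs_le hs).trans hτ.1, hτ.2.le.trans (le_of_abs_le ht)⟩
  rw [this]
  simp [abs_sub_comm s t, abs_of_nonneg (sub_nonneg.mpr hst), hst]

theorem abs_cond_neg {ι : Type*} [Fintype ι] (s c : ι → ℝ) (hc : ∑ i, c i = 0) :
    ∑ i, c i * ∑ j, |s i - s j| * c j ≤ 0 := by
  classical
  set R : ℝ := ∑ i, |s i|
  have hR : ∀ i, |s i| ≤ R := fun i =>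
    Finset.single_le_sum (f := fun i => |s i|) (fun i _ => abs_nonneg _) (Finset.mem_univ i)
  set χ : ι → ℝ → ℝ := fun i => (Set.Iio (s i)).indicator (fun _ => (1 : ℝ)) with hχ
  have h_integrable : ∀ i j, Integrable (fun τ => (χ i τ - χ j τ) ^ 2)
      (volume.restrict (Set.Icc (-R) R)) := by
    intro i j
    refine Integrable.of_bound (C := 1) ?_ ?_
    · apply Measurable.aestronglyMeasurable
      have : ∀ i, Measurable (χ i) := fun i => measurable_const.indicator measurableSet_Iio
      exact ((this i).sub (this j)).pow_const 2
    · refine Eventually.of_forall fun τ => ?_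
      simp only [hχ, Set.indicator, Set.mem_Iio]
      split_ifs <;> simp
  have e : ∑ i, c i * ∑ j, |s i - s j| * c j =
      ∫ τ in Set.Icc (-R) R, ∑ i, ∑ j, c i * c j * (χ i τ - χ j τ) ^ 2 := by
    rw [integral_finsetSum _ (fun i _ => integrable_finsetSum _ fun j _ => (h_integrable i j).const_mul _)]
    refine Finset.sum_congr rfl fun i _ => ?_
    rw [integral_finsetSum _ (fun j _ => (h_integrable i j).const_mul _), Finset.mul_sum]
    refine Finset.sum_congr rfl fun j _ => ?_
    rw [integral_const_mul, ← abs_sub_eq_integral R _ _ (hR i) (hR j)]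
    ring
  rw [e]
  refine integral_nonpos fun τ => ?_
  have : ∑ i, ∑ j, c i * c j * (χ i τ - χ j τ) ^ 2 =
      2 * ((∑ i, c i * χ i τ ^ 2) * (∑ j, c j)) - 2 * ((∑ i, c i * χ i τ) * ∑ j, c j * χ j τ) := by
    have t1 : (∑ i, c i * χ i τ ^ 2) * (∑ j, c j) = ∑ i, ∑ j, c i * c j * χ i τ ^ 2 := by
      rw [Finset.sum_mul_sum]
      refine Finset.sum_congr rfl fun i _ => Finset.sum_congr rfl fun j _ => by ring
    have t2 : (∑ i, c i * χ i τ ^ 2) * (∑ j, c j) = ∑ i, ∑ j, c i * c j * χ j τ ^ 2 := by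
      rw [t1, Finset.sum_comm]
      refine Finset.sum_congr rfl fun i _ => Finset.sum_congr rfl fun j _ => by ring
    have t3 : (∑ i, c i * χ i τ) * ∑ j, c j * χ j τ = ∑ i, ∑ j, c i * c j * (χ i τ * χ j τ) := by
      rw [Finset.sum_mul_sum]
      refine Finset.sum_congr rfl fun i _ => Finset.sum_congr rfl fun j _ => by ring
    rw [t3, two_mul ((∑ i, c i * χ i τ ^ 2) * (∑ j, c j))]
    nth_rewrite 1 [t1]
    rw [t2]
    simp only [Finset.mul_sum, ← Finset.sum_sub_distrib, ← Finset.sum_add_distrib]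
    refine Finset.sum_congr rfl fun i _ => Finset.sum_congr rfl fun j _ => by ring
  simp only [Pi.zero_apply]
  rw [this, hc]
  nlinarith [mul_self_nonneg (∑ i, c i * χ i τ)]

/-- planar case -/
theorem planar_hyperbolic {ι V : Type*} [Fintype ι] [AddCommGroup V] [Module ℝ V]
    (hV : Module.finrank ℝ V = 2) (ω : V [⋀^Fin 2]→ₗ[ℝ] ℝ) (y : ι → V)
    (v x : ι → ℝ) (hx : 0 ≤ ∑ i, x i * ∑ j, |ω ![y i, y j]| * x j) :
    (∑ i, v i * ∑ j, |ω ![y i, y j]| * v j) * (∑ i, x i * ∑ j, |ω ![y i, y j]| * x j) ≤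
      (∑ i, v i * ∑ j, |ω ![y i, y j]| * x j) ^ 2 := by
  classical
  rcases hx.eq_or_lt with hx | hx
  · rw [← hx, mul_zero]; positivity
  have : FiniteDimensional ℝ V := Module.finite_of_finrank_pos (by omega)
  set b := Module.finBasisOfFinrankEq ℝ V hV
  set a0 : ι → ℝ := fun i => b.repr (y i) 0 with ha0
  set a1 : ι → ℝ := fun i => b.repr (y i) 1 with ha1
  set k := ω b
  have hω : ∀ i j, ω ![y i, y j] = k * (a0 i * a1 j - a0 j * a1 i) := by
    intro i j
    rw [ω.eq_smul_basis_det b]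
    simp [Module.Basis.det_apply, Matrix.det_fin_two, Module.Basis.toMatrix_apply, ha0, ha1, k]
  obtain ⟨τ, hτ⟩ : ∃ τ : ℝ, ∀ i, a0 i + τ * a1 i = 0 → a0 i = 0 ∧ a1 i = 0 := by
    have hfin : (Set.range fun i => - a0 i / a1 i).Finite := Set.finite_range _
    obtain ⟨τ, hτ⟩ := hfin.exists_notMem
    refine ⟨τ, fun i hi => ?_⟩
    by_cases h1 : a1 i = 0
    · rw [h1] at hi; exact ⟨by simpa using hi, h1⟩
    · exact absurd ⟨i, by field_simp; linarith⟩ hτ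
  set g : ι → ℝ := fun i => a0 i + τ * a1 i with hg
  set s : ι → ℝ := fun i => a1 i / g i with hs
  have hω2 : ∀ i j, |ω ![y i, y j]| = |k| * (|g i| * |g j| * |s i - s j|) := by
    intro i j
    rw [hω, ← abs_mul, ← abs_mul, ← abs_mul]
    by_cases hi : g i = 0
    · simp [hi, hτ i hi]
    by_cases hj : g j = 0
    · simp [hj, hτ j hj]
    have : g i * g j * (s i - s j) = -(a0 i * a1 j - a0 j * a1 i) := by
      have e1 : g i * s i = a1 i := by simp only [hs]; field_simp
      have e2 : g j * s j = a1 j := by simp only [hs]; field_simp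
      have : g i * g j * (s i - s j) = g j * (g i * s i) - g i * (g j * s j) := by ring
      rw [this, e1, e2]; simp only [hg]; ring
    rw [this, mul_neg, abs_neg]
  have hneg : ∀ z : ι → ℝ, ∑ i, z i * |g i| = 0 → ∑ i, z i * ∑ j, |ω ![y i, y j]| * z j ≤ 0 := by
    intro z hz
    have h1 := abs_cond_neg s (fun i => z i * |g i|) hz
    have : ∑ i, z i * ∑ j, |ω ![y i, y j]| * z j =
        |k| * ∑ i, z i * |g i| * ∑ j, |s i - s j| * (z j * |g j|) := by
      simp only [Finset.mul_sum, hω2]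
      refine Finset.sum_congr rfl fun i _ => Finset.sum_congr rfl fun j _ => by ring
    rw [this]
    exact mul_nonpos_of_nonneg_of_nonpos (abs_nonneg _) h1
  have hsym : ∀ i j, |ω ![y i, y j]| = |ω ![y j, y i]| := by
    intro i j; rw [hω2, hω2, abs_sub_comm]; ring
  have hl : ∑ i, x i * |g i| ≠ 0 := fun h => absurd (hneg x h) (not_le.mpr hx)
  set c : ℝ := (∑ i, v i * |g i|) / (∑ i, x i * |g i|) with hc
  have h1 := hneg (fun i => v i - c * x i) (by
    have : ∑ i, (v i - c * x i) * |g i| = ∑ i, v i * |g i| - c * ∑ i, x i * |g i| := by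
      rw [Finset.mul_sum, ← Finset.sum_sub_distrib]
      refine Finset.sum_congr rfl fun i _ => by ring
    rw [this, hc, div_mul_cancel₀ _ hl, sub_self])
  rw [quad_expand (fun i j => |ω ![y i, y j]|) hsym v x c] at h1
  exact disc_aux _ _ _ c hx h1

section Step
universe u
variable {V : Type u} [AddCommGroup V] [Module ℝ V]

theorem form_shift (u : V) {k : ℕ} (φ : V [⋀^Fin k]→ₗ[ℝ] ℝ)
    (hφ : ∀ (v : Fin k → V) (i : Fin k), v i = u → φ v = 0) (f : V → V)
    (hf : ∀ v, ∃ c : ℝ, f v = v + c • u) (w : Fin k → V) :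
    φ (fun i => f (w i)) = φ w := by
  induction k with
  | zero => congr 1; exact Subsingleton.elim _ _
  | succ k ih =>
    have hcons : ∀ v : Fin (k + 1) → V, φ v = φ.curryLeft (v 0) (fun i => v i.succ) := by
      intro v
      rw [AlternatingMap.curryLeft_apply_apply]
      congr 1
      ext i
      refine Fin.cases ?_ (fun j => ?_) i <;> simp
    obtain ⟨c, hc⟩ := hf (w 0)
    have h0 : φ.curryLeft u = 0 := by
      ext v
      rw [AlternatingMap.curryLeft_apply_apply]
      exact hφ _ 0 (by simp)
    rw [hcons, hcons w, hc, map_add, map_smul, h0, smul_zero, add_zero]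
    refine ih _ ?_ _
    intro v i hv
    rw [AlternatingMap.curryLeft_apply_apply]
    exact hφ _ i.succ (by simpa using hv)

/-- restriction along a complementary projection -/
theorem exists_reduction {m : ℕ} (hV : Module.finrank ℝ V = m + 1) (u : V) (hu : u ≠ 0)
    (ω : V [⋀^Fin (m + 1)]→ₗ[ℝ] ℝ) :
    ∃ (W : Submodule ℝ V) (f : V →ₗ[ℝ] W), Module.finrank ℝ W = m ∧
      ω.curryLeft u = ((ω.curryLeft u).compLinearMap W.subtype).compLinearMap f ∧
      (∀ v, f v = 0 → v ∈ Submodule.span ℝ {u}) ∧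
      (ω ≠ 0 → (ω.curryLeft u).compLinearMap W.subtype ≠ 0) := by
  have : FiniteDimensional ℝ V := Module.finite_of_finrank_pos (by omega)
  obtain ⟨W, hW⟩ := Submodule.exists_isCompl (Submodule.span ℝ {u})
  have hWr : Module.finrank ℝ W = m := by
    have := Submodule.finrank_add_eq_of_isCompl hW
    rw [finrank_span_singleton hu] at this
    omega
  have hsub : ∀ v : V, ∃ c : ℝ, (W.projectionOnto _ hW.symm v : V) = v + c • u := by
    intro v
    have h1 : v - (W.projectionOnto _ hW.symm v : V) ∈ Submodule.span ℝ {u} := by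
      rw [← Submodule.projectionOnto_apply_eq_zero_iff hW.symm, map_sub,
        Submodule.projectionOnto_apply_left, sub_self]
    obtain ⟨c, hc⟩ := Submodule.mem_span_singleton.mp h1
    exact ⟨-c, by rw [neg_smul, hc]; abel⟩
  refine ⟨W, W.projectionOnto _ hW.symm, hWr, ?_, ?_, ?_⟩
  · ext w
    rw [AlternatingMap.compLinearMap_apply, AlternatingMap.compLinearMap_apply]
    refine (form_shift u _ ?_ (fun v => (W.projectionOnto _ hW.symm v : V)) hsub w).symm
    intro v i hv
    rw [AlternatingMap.curryLeft_apply_apply]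
    exact ω.map_eq_zero_of_eq _ (i := 0) (j := i.succ) (by simp [hv]) (Fin.succ_ne_zero i).symm
  · intro v hv
    exact (Submodule.projectionOnto_apply_eq_zero_iff hW.symm).mp hv
  · intro hω h0
    have hli : ∀ (c : ℝ), ∀ z ∈ W, c • u + z = 0 → c = 0 := by
      intro c z hz hcz
      have h1 : z ∈ Submodule.span ℝ {u} := by
        rw [Submodule.mem_span_singleton]
        exact ⟨-c, by rw [neg_smul]; exact (eq_neg_of_add_eq_zero_right hcz).symm⟩
      have h2 : z = 0 := Submodule.disjoint_def.mp hW.disjoint z h1 hz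
      rw [h2, add_zero, smul_eq_zero] at hcz
      exact hcz.resolve_right hu
    have hsp : ∀ z : V, ∃ c : ℝ, z + c • u ∈ W := by
      intro z
      obtain ⟨c, hc⟩ := hsub z
      exact ⟨c, hc ▸ (W.projectionOnto _ hW.symm z).2⟩
    let b := Module.finBasisOfFinrankEq ℝ W hWr
    let B := Module.Basis.mkFinCons u b hli hsp
    apply (ω.map_basis_ne_zero_iff B).mpr hω
    have := congrArg (fun φ => φ b) h0
    simp only [AlternatingMap.compLinearMap_apply, AlternatingMap.curryLeft_apply_apply,
      AlternatingMap.zero_apply] at this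
    rw [← this, Module.Basis.coe_mkFinCons]
    rfl

theorem curry_curry_ne_zero {m : ℕ} (hV : Module.finrank ℝ V = m + 2) (u v : V) (hu : u ≠ 0)
    (hv : v ∉ Submodule.span ℝ {u}) (ω : V [⋀^Fin (m + 2)]→ₗ[ℝ] ℝ) (hω : ω ≠ 0) :
    (ω.curryLeft u).curryLeft v ≠ 0 := by
  obtain ⟨W, f, hW, h1, h2, h3⟩ := exists_reduction hV u hu ω
  set φ := (ω.curryLeft u).compLinearMap W.subtype
  have hφ : φ ≠ 0 := h3 hω
  have hfv : f v ≠ 0 := fun h => hv (h2 v h)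
  obtain ⟨W', f', hW', h1', h2', h3'⟩ := exists_reduction hW (f v) hfv φ
  have h4 := h3' hφ
  intro h0
  apply h4
  rw [h1, AlternatingMap.curryLeft_compLinearMap] at h0
  have hsurj : ∀ w : W, ∃ z : V, f z = w := by
    have : FiniteDimensional ℝ V := Module.finite_of_finrank_pos (by omega)
    have hr : Module.finrank ℝ (LinearMap.range f) = m + 1 := by
      have e := LinearMap.finrank_range_add_finrank_ker f
      have hk : Module.finrank ℝ (LinearMap.ker f) ≤ 1 := by
        have hle : LinearMap.ker f ≤ Submodule.span ℝ {u} := fun z hz => h2 z hz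
        have := Submodule.finrank_mono hle
        rwa [finrank_span_singleton hu] at this
      have : Module.finrank ℝ (LinearMap.range f) ≤ Module.finrank ℝ W := Submodule.finrank_le _
      omega
    have : LinearMap.range f = ⊤ := Submodule.eq_top_of_finrank_eq (by rw [hr, hW])
    exact LinearMap.range_eq_top.mp this
  choose g hg using hsurj
  ext w
  have := congrArg (fun ψ => ψ (fun i => g (w i))) h0
  simp only [AlternatingMap.compLinearMap_apply, hg] at this
  simpa using this

variable {ι : Type*} [Fintype ι]

/-- The Alexandrov-Fenchel type inequality, by induction on the dimension. -/
theorem hyperbolic_main (m : ℕ) : ∀ (V : Type u) [AddCommGroup V] [Module ℝ V]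
    (_ : Module.finrank ℝ V = m + 2) (ω : V [⋀^Fin (m + 2)]→ₗ[ℝ] ℝ) (y : ι → V)
    (x : ι → ℝ) (_ : ∀ i, 0 < x i) (v : ι → ℝ),
    (∑ i, v i * ∑ j, PP y x m ((ω.curryLeft (y i)).curryLeft (y j)) * v j) *
      PP y x (m + 2) ω ≤ (∑ i, v i * PP y x (m + 1) (ω.curryLeft (y i))) ^ 2 := by
  induction m with
  | zero =>
    intro V _ _ hV ω y x hx v
    have h := planar_hyperbolic hV ω y v x
      (Finset.sum_nonneg fun i _ => mul_nonneg (hx i).le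
        (Finset.sum_nonneg fun j _ => mul_nonneg (abs_nonneg _) (hx j).le))
    have e : ∀ i j, PP y x 0 ((ω.curryLeft (y i)).curryLeft (y j)) = |ω ![y i, y j]| := by
      intro i j
      simp only [PP, AlternatingMap.curryLeft_apply_apply]
      congr 2
      ext k; fin_cases k <;> rfl
    simp only [PP_succ, e]
    have e2 : ∀ i, ∑ j, x j * |ω ![y i, y j]| = ∑ j, |ω ![y i, y j]| * x j :=
      fun i => Finset.sum_congr rfl fun j _ => mul_comm _ _
    simp only [e2]
    exact h
  | succ m ih =>
    intro V _ _ hV ω y x hx v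
    have hx0 : ∀ i, 0 ≤ x i := fun i => (hx i).le
    have : FiniteDimensional ℝ V := Module.finite_of_finrank_pos (by omega)
    by_cases hP : PP y x (m + 1 + 2) ω = 0
    · rw [hP, mul_zero]; positivity
    have hω : ω ≠ 0 := fun h => hP (by rw [h, PP_zero_form])
    have hspan : Submodule.span ℝ (Set.range y) = ⊤ := by
      by_contra hne
      apply hP
      rw [PP_eq_sum]
      refine Finset.sum_eq_zero fun i _ => ?_
      rw [ω.map_linearDependent, abs_zero, mul_zero]
      intro hli
      apply hne
      have h1 := hli.span_eq_top_of_card_eq_finrank' (by simp [hV])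
      rw [eq_top_iff, ← h1]
      apply Submodule.span_mono
      rintro _ ⟨k, rfl⟩
      exact ⟨i k, rfl⟩
    set H : ι → ι → ℝ := fun i j => PP y x (m + 1) ((ω.curryLeft (y i)).curryLeft (y j)) with hH
    have hHx : ∀ i, ∑ j, H i j * x j = PP y x (m + 2) (ω.curryLeft (y i)) := by
      intro i
      rw [PP_succ]
      exact Finset.sum_congr rfl fun j _ => mul_comm _ _
    have key := hyperbolic_of_bochner H (fun i j => PP_swap y x ω _ _)
      (fun i j => PP_nonneg y x hx0 _ _) x hx ?_ ?_ v
    · simp only [hHx] at key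
      have e : PP y x (m + 1 + 2) ω = ∑ i, x i * PP y x (m + 2) (ω.curryLeft (y i)) := rfl
      rw [e]
      exact key
    · -- Bochner inequality
      intro v
      have e1 : ∑ i, v i * ∑ j, H i j * v j =
          ∑ k, x k * ∑ i, v i * ∑ j,
            PP y x m (((ω.curryLeft (y k)).curryLeft (y i)).curryLeft (y j)) * v j := by
        have e2 : ∀ i j, H i j =
            ∑ k, x k * PP y x m (((ω.curryLeft (y k)).curryLeft (y i)).curryLeft (y j)) := by
          intro i j
          simp only [hH]
          rw [PP_succ]
          refine Finset.sum_congr rfl fun k _ => ?_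
          rw [PP_swap y x (ω.curryLeft (y i)) (y j) (y k), curry_swap ω (y i) (y k)]
          congr 1
          rw [← PP_neg]
          congr 1
          ext w
          simp
        simp only [e2, Finset.mul_sum, Finset.sum_mul]
        rw [Finset.sum_congr rfl fun i _ => Finset.sum_comm]
        rw [Finset.sum_comm]
        refine Finset.sum_congr rfl fun k _ => Finset.sum_congr rfl fun i _ =>
          Finset.sum_congr rfl fun j _ => by ring
      rw [e1]
      refine Finset.sum_le_sum fun k _ => ?_
      rw [mul_div_assoc]
      refine mul_le_mul_of_nonneg_left ?_ (hx0 k)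
      rw [hHx]
      by_cases hk : PP y x (m + 2) (ω.curryLeft (y k)) = 0
      · rw [hk, div_zero]
        refine le_of_eq (Finset.sum_eq_zero fun i _ => ?_)
        rw [Finset.sum_eq_zero, mul_zero]
        intro j _
        rw [PP_succ_eq_zero y x hx _ _ (PP_succ_eq_zero y x hx _ _ hk i) j, zero_mul]
      have hkpos : 0 < PP y x (m + 2) (ω.curryLeft (y k)) :=
        lt_of_le_of_ne (PP_nonneg y x hx0 _ _) (Ne.symm hk)
      rw [le_div_iff₀ hkpos]
      have hyk : y k ≠ 0 := by
        intro h; apply hk; rw [h, map_zero, PP_zero_form]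
      obtain ⟨W, f, hW, h1, -, -⟩ := exists_reduction hV (y k) hyk ω
      have h2 := ih W hW ((ω.curryLeft (y k)).compLinearMap W.subtype) (fun i => f (y i)) x hx v
      simp only [← PP_comp f, ← AlternatingMap.curryLeft_compLinearMap f] at h2
      rw [← h1] at h2
      refine h2.trans (le_of_eq ?_)
      congr 1
      exact Finset.sum_congr rfl fun j _ => mul_comm _ _
    · -- connectivity
      intro r hr
      have hne : ∀ i j, y i ≠ 0 → y j ∉ Submodule.span ℝ {y i} → r i = r j := by
        intro i j hi hj
        apply hr
        intro h0
        exact curry_curry_ne_zero hV _ _ hi hj ω hω (form_zero_of_PP y x hx hspan _ _ h0)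
      have hout : ∀ i, y i ≠ 0 → ∃ l, y l ∉ Submodule.span ℝ {y i} := by
        intro i hi
        by_contra hcon
        push Not at hcon
        have hle : (⊤ : Submodule ℝ V) ≤ Submodule.span ℝ {y i} := by
          rw [← hspan, Submodule.span_le]
          rintro _ ⟨l, rfl⟩
          exact hcon l
        have h1 := Submodule.finrank_mono hle
        rw [finrank_top, finrank_span_singleton hi, hV] at h1
        omega
      have hall : ∀ i j, y i ≠ 0 → y j ≠ 0 → r i = r j := by
        intro i j hi hj
        by_cases hij : y j ∈ Submodule.span ℝ {y i}
        · obtain ⟨l, hl⟩ := hout i hi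
          have hl' : y l ∉ Submodule.span ℝ {y j} := by
            intro h
            apply hl
            have : Submodule.span ℝ {y j} ≤ Submodule.span ℝ {y i} := by
              rw [Submodule.span_le]; simpa using hij
            exact this h
          rw [hne i l hi hl, hne j l hj hl']
        · exact hne i j hi hij
      by_cases hex : ∃ i, y i ≠ 0
      · obtain ⟨i0, hi0⟩ := hex
        refine ⟨r i0, fun i hi => hall i i0 ?_ hi0⟩
        intro h
        apply hi
        rw [hHx, h, map_zero, PP_zero_form]
      · push Not at hex
        refine ⟨0, fun i hi => absurd ?_ hi⟩
        rw [hHx, hex i, map_zero, PP_zero_form]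

end Step

theorem finite_concave_pos {ι V : Type*} [Fintype ι] [AddCommGroup V] [Module ℝ V] (m : ℕ)
    (hV : Module.finrank ℝ V = m + 1) (ω : V [⋀^Fin (m + 1)]→ₗ[ℝ] ℝ) (y : ι → V)
    (a b : ι → ℝ) (ha : ∀ i, 0 < a i) (hb : ∀ i, 0 < b i) :
    ConcaveOn ℝ (Set.Icc (0 : ℝ) 1)
      (fun t => PP y (fun i => a i + t * (b i - a i)) (m + 1) ω ^ ((1 : ℝ) / ((m + 1 : ℕ) : ℝ))) := by
  set d : ι → ℝ := fun i => b i - a i with hd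
  set X : ℝ → ι → ℝ := fun t i => a i + t * d i with hX
  have hXpos : ∀ t ∈ Set.Icc (0 : ℝ) 1, ∀ i, 0 < X t i := by
    intro t ht i
    have : X t i = (1 - t) * a i + t * b i := by simp only [hX, hd]; ring
    rw [this]
    rcases ht.1.eq_or_lt with h | h
    · rw [← h]; simpa using ha i
    · have := mul_nonneg (sub_nonneg.mpr ht.2) (ha i).le
      have := mul_pos h (hb i)
      linarith
  set f : ℝ → ℝ := fun t => PP y (X t) (m + 1) ω with hf
  by_cases h0 : f 0 = 0
  · have hz : ∀ t, f t = 0 := fun t => PP_eq_zero_all y (X 0) (hXpos 0 (by simp)) _ _ _ h0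
    have : (fun t => f t ^ ((1 : ℝ) / ((m + 1 : ℕ) : ℝ))) =
        fun _ => (0 : ℝ) ^ ((1 : ℝ) / ((m + 1 : ℕ) : ℝ)) := by
      ext t; rw [hz]
    change ConcaveOn ℝ _ (fun t => f t ^ ((1 : ℝ) / ((m + 1 : ℕ) : ℝ)))
    rw [this]
    exact concaveOn_const _ (convex_Icc _ _)
  have hfpos : ∀ t ∈ Set.Icc (0 : ℝ) 1, 0 < f t := by
    intro t ht
    refine lt_of_le_of_ne (PP_nonneg y _ (fun i => (hXpos t ht i).le) _ _) (Ne.symm ?_)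
    intro h
    exact h0 (PP_eq_zero_all y (X t) (hXpos t ht) _ _ _ h)
  set f1 : ℝ → ℝ := fun t => (m + 1 : ℝ) * ∑ i, d i * PP y (X t) m (ω.curryLeft (y i)) with hf1
  have hd1 : ∀ t, HasDerivAt f (f1 t) t := fun t => PP_hasDerivAt y a d (m + 1) ω t
  obtain ⟨f2, hd2, hf2⟩ : ∃ f2 : ℝ → ℝ, (∀ t, HasDerivAt f1 (f2 t) t) ∧
      ∀ t ∈ Set.Icc (0 : ℝ) 1, f t * f2 t ≤ (1 - 1 / ((m + 1 : ℕ) : ℝ)) * f1 t ^ 2 := by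
    cases m with
    | zero =>
      refine ⟨fun _ => 0, fun t => ?_, fun t _ => by simp⟩
      have : f1 = fun _ => f1 t := by
        ext s; simp [hf1, PP]
      rw [this]
      exact hasDerivAt_const _ _
    | succ m =>
      refine ⟨fun t => ((m + 1 : ℕ) + 1 : ℝ) * ∑ i, d i * ((m + 1 : ℝ) *
        ∑ j, d j * PP y (X t) m ((ω.curryLeft (y i)).curryLeft (y j))), fun t => ?_, fun t ht => ?_⟩
      · exact (HasDerivAt.fun_sum fun i _ =>
          (PP_hasDerivAt y a d (m + 1) (ω.curryLeft (y i)) t).const_mul (d i)).const_mul _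
      · have key := hyperbolic_main m V hV ω y (X t) (hXpos t ht) d
        have e1 : ∑ i, d i * ((m + 1 : ℝ) *
            ∑ j, d j * PP y (X t) m ((ω.curryLeft (y i)).curryLeft (y j))) =
            (m + 1 : ℝ) * ∑ i, d i *
              ∑ j, PP y (X t) m ((ω.curryLeft (y i)).curryLeft (y j)) * d j := by
          simp only [Finset.mul_sum]
          refine Finset.sum_congr rfl fun i _ => Finset.sum_congr rfl fun j _ => by ring
        beta_reduce
        rw [e1]
        simp only [hf, hf1]
        set A := ∑ i, d i * ∑ j, PP y (X t) m ((ω.curryLeft (y i)).curryLeft (y j)) * d j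
        set C := ∑ i, d i * PP y (X t) (m + 1) (ω.curryLeft (y i))
        have hP : PP y (X t) (m + 1 + 1) ω = PP y (X t) (m + 2) ω := rfl
        rw [hP]
        set P := PP y (X t) (m + 2) ω
        have e2 : (1 - 1 / ((m + 1 + 1 : ℕ) : ℝ)) * (((m + 1 : ℕ) + 1 : ℝ) * C) ^ 2 =
            ((m + 1 : ℕ) + 1 : ℝ) * (m + 1 : ℝ) * C ^ 2 := by
          push_cast
          have : (m + 1 + 1 : ℝ) ≠ 0 := by positivity
          field_simp
          ring
        rw [e2]
        have : ((m + 1 : ℕ) + 1 : ℝ) * (m + 1 : ℝ) * (A * P) ≤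
            ((m + 1 : ℕ) + 1 : ℝ) * (m + 1 : ℝ) * C ^ 2 :=
          mul_le_mul_of_nonneg_left key (by positivity)
        calc _ = ((m + 1 : ℕ) + 1 : ℝ) * (m + 1 : ℝ) * (A * P) := by ring
          _ ≤ _ := this
  set p : ℝ := (1 : ℝ) / ((m + 1 : ℕ) : ℝ) with hp
  have hp0 : 0 < p := by positivity
  refine concaveOn_of_hasDerivWithinAt2_nonpos (f' := fun t => f1 t * p * f t ^ (p - 1))
    (f'' := fun t => p * f t ^ (p - 2) * (f t * f2 t - (1 - p) * f1 t ^ 2)) (convex_Icc _ _) ?_ ?_ ?_ ?_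
  · intro t ht
    exact ((hd1 t).continuousAt.rpow_const (Or.inr hp0.le)).continuousWithinAt
  · intro t ht
    have ht' := interior_subset ht
    exact ((hd1 t).rpow_const (Or.inl (hfpos t ht').ne')).hasDerivWithinAt
  · intro t ht
    have ht' := interior_subset ht
    have hpos := hfpos t ht'
    have h1 := ((hd2 t).mul_const p).mul
      ((hd1 t).rpow_const (p := p - 1) (Or.inl hpos.ne'))
    refine (h1.congr_deriv ?_).hasDerivWithinAt
    have e1 : f t ^ (p - 1) = f t ^ (p - 2) * f t := by
      have : p - 1 = (p - 2) + 1 := by ring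
      rw [this, Real.rpow_add hpos, Real.rpow_one]
    have e2 : p - 1 - 1 = p - 2 := by ring
    rw [e2, e1]; ring
  · intro t ht
    have ht' := interior_subset ht
    refine mul_nonpos_of_nonneg_of_nonpos ?_ ?_
    · exact mul_nonneg hp0.le (Real.rpow_nonneg (hfpos t ht').le _)
    · have := hf2 t ht'
      linarith

theorem concaveOn_of_tendsto {s : Set ℝ} (hs : Convex ℝ s) {F : ℕ → ℝ → ℝ} {f : ℝ → ℝ}
    (hF : ∀ k, ConcaveOn ℝ s (F k)) (h : ∀ t ∈ s, Tendsto (fun k => F k t) atTop (𝓝 (f t))) :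
    ConcaveOn ℝ s f := by
  refine ⟨hs, fun x hx y hy a b ha hb hab => ?_⟩
  refine le_of_tendsto_of_tendsto (((h x hx).const_smul a).add ((h y hy).const_smul b))
    (h _ (hs hx hy ha hb hab)) (Eventually.of_forall fun k => ?_)
  exact (hF k).2 hx hy ha hb hab

theorem PP_continuous {ι V : Type*} [Fintype ι] [AddCommGroup V] [Module ℝ V] (m : ℕ)
    (ω : V [⋀^Fin m]→ₗ[ℝ] ℝ) (y : ι → V) : Continuous (fun x : ι → ℝ => PP y x m ω) := by
  simp only [PP_eq_sum]
  fun_prop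

theorem finite_concave {ι V : Type*} [Fintype ι] [AddCommGroup V] [Module ℝ V] (m : ℕ)
    (hV : Module.finrank ℝ V = m + 1) (ω : V [⋀^Fin (m + 1)]→ₗ[ℝ] ℝ) (y : ι → V)
    (a b : ι → ℝ) (ha : ∀ i, 0 ≤ a i) (hb : ∀ i, 0 ≤ b i) :
    ConcaveOn ℝ (Set.Icc (0 : ℝ) 1)
      (fun t => PP y (fun i => (1 - t) * a i + t * b i) (m + 1) ω ^
        ((1 : ℝ) / ((m + 1 : ℕ) : ℝ))) := by
  have hε : ∀ k : ℕ, (0 : ℝ) < 1 / ((k : ℝ) + 1) := fun k => by positivity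
  refine concaveOn_of_tendsto (convex_Icc _ _)
    (fun k => finite_concave_pos m hV ω y (fun i => a i + 1 / ((k : ℝ) + 1))
      (fun i => b i + 1 / ((k : ℝ) + 1)) (fun i => add_pos_of_nonneg_of_pos (ha i) (hε k))
      (fun i => add_pos_of_nonneg_of_pos (hb i) (hε k))) ?_
  intro t _
  refine Tendsto.rpow_const ?_ (Or.inr (by positivity))
  refine ((PP_continuous (m + 1) ω y).tendsto _).comp ?_
  rw [tendsto_pi_nhds]
  intro i
  have h1 := (tendsto_one_div_add_atTop_nhds_zero_nat (𝕜 := ℝ)).const_add ((1 - t) * a i + t * b i)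
  rw [add_zero] at h1
  refine h1.congr fun k => by ring

theorem suppFn_segment {n : ℕ} (y ξ : EuclideanSpace ℝ (Fin n)) :
    suppFn (segment ℝ 0 y) ξ = max ⟪y, ξ⟫ 0 := by
  unfold suppFn
  apply IsGreatest.csSup_eq
  rw [segment_eq_image]
  constructor
  · rcases le_total ⟪y, ξ⟫ 0 with h | h
    · exact ⟨0, ⟨0, by simp, by simp⟩, by simp [h]⟩
    · exact ⟨y, ⟨1, by simp, by simp⟩, by simp [h]⟩
  · rintro _ ⟨_, ⟨θ, hθ, rfl⟩, rfl⟩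
    simp only [smul_zero, zero_add, inner_smul_left, RCLike.conj_to_real]
    rcases le_total ⟪y, ξ⟫ 0 with h | h
    · exact le_max_of_le_right (mul_nonpos_of_nonneg_of_nonpos hθ.1 h)
    · exact le_max_of_le_left (mul_le_of_le_one_left h hθ.2)

theorem suppFn_integrable {n : ℕ} (ν : Measure (EuclideanSpace ℝ (Fin n)))
    (h : Integrable (fun y => ‖y‖) ν) (ξ : EuclideanSpace ℝ (Fin n)) :
    Integrable (fun y => suppFn (segment ℝ 0 y) ξ) ν := by
  simp only [suppFn_segment]
  refine (h.mul_const ‖ξ‖).mono' (by fun_prop) (Eventually.of_forall fun y => ?_)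
  have h1 := abs_real_inner_le_norm y ξ
  rw [Real.norm_eq_abs, abs_of_nonneg (le_max_right _ _)]
  exact max_le ((le_abs_self _).trans h1) (by positivity)

theorem bddAbove_inner {n : ℕ} {A : Set (EuclideanSpace ℝ (Fin n))} (hA : IsCompact A)
    (ξ : EuclideanSpace ℝ (Fin n)) : BddAbove ((fun ζ => ⟪ζ, ξ⟫) '' A) :=
  (hA.image (by fun_prop)).bddAbove

theorem subset_of_suppFn {n : ℕ} {A B : Set (EuclideanSpace ℝ (Fin n))} (hA : IsCompact A)
    (hB : IsCompact B) (hBc : Convex ℝ B) (hBn : B.Nonempty)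
    (h : ∀ ξ, suppFn A ξ ≤ suppFn B ξ) : A ⊆ B := by
  intro x hx
  by_contra hxB
  obtain ⟨f, u, h1, h2⟩ := geometric_hahn_banach_closed_point hBc hB.isClosed hxB
  set ξ := (InnerProductSpace.toDual ℝ _).symm f with hξ
  have hf : ∀ z, ⟪z, ξ⟫ = f z := by
    intro z
    rw [real_inner_comm, hξ, InnerProductSpace.toDual_symm_apply]
  have e1 : suppFn B ξ ≤ u := by
    apply csSup_le (hBn.image _)
    rintro _ ⟨z, hz, rfl⟩
    simp only [hf]
    exact (h1 z hz).le
  have e2 : f x ≤ suppFn A ξ := by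
    rw [← hf]
    exact le_csSup (bddAbove_inner hA ξ) ⟨x, hx, rfl⟩
  linarith [h ξ]

theorem suppFn_comb {n : ℕ} {A B : Set (EuclideanSpace ℝ (Fin n))} (hA : IsCompact A)
    (hB : IsCompact B) (hAn : A.Nonempty) (hBn : B.Nonempty) (s t : ℝ) (hs : 0 ≤ s) (ht : 0 ≤ t)
    (ξ : EuclideanSpace ℝ (Fin n)) :
    suppFn (s • A + t • B) ξ = s * suppFn A ξ + t * suppFn B ξ := by
  unfold suppFn
  set φ : EuclideanSpace ℝ (Fin n) →ₗ[ℝ] ℝ := (innerₗ _).flip ξ with hφ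
  have e : (fun ζ : EuclideanSpace ℝ (Fin n) => ⟪ζ, ξ⟫) = φ := by
    ext z
    simp [hφ]
    exact real_inner_comm ξ z
  have bA := bddAbove_inner hA ξ
  have bB := bddAbove_inner hB ξ
  rw [e] at bA bB ⊢
  rw [Set.image_add, image_smul_set, image_smul_set,
    csSup_add ((hAn.image _).smul_set) (bA.smul_of_nonneg hs)
      ((hBn.image _).smul_set) (bB.smul_of_nonneg ht),
    Real.sSup_smul_of_nonneg hs, Real.sSup_smul_of_nonneg ht, smul_eq_mul, smul_eq_mul]

theorem integral_simple_eq_PP {n : ℕ} (μ : Measure (EuclideanSpace ℝ (Fin n)))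
    [IsProbabilityMeasure μ] (g : SimpleFunc (EuclideanSpace ℝ (Fin n)) (EuclideanSpace ℝ (Fin n)))
    (ω : (EuclideanSpace ℝ (Fin n)) [⋀^Fin n]→ₗ[ℝ] ℝ) :
    ∫ v : Fin n → EuclideanSpace ℝ (Fin n), |ω (fun j => g (v j))| ∂(Measure.pi fun _ => μ) =
      PP (fun i : g.range => (i : EuclideanSpace ℝ (Fin n)))
        (fun i => μ.real (g ⁻¹' {(i : EuclideanSpace ℝ (Fin n))})) n ω := by
  classical
  set G : EuclideanSpace ℝ (Fin n) → g.range := fun v => ⟨g v, g.mem_range_self v⟩ with hG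
  have hGm : Measurable G := g.measurable.subtype_mk
  have : IsProbabilityMeasure (μ.map G) := Measure.isProbabilityMeasure_map hGm.aemeasurable
  have h1 : (Measure.pi fun _ : Fin n => μ).map (fun v j => G (v j)) =
      Measure.pi fun _ : Fin n => μ.map G :=
    Measure.pi_map_pi (fun _ => hGm.aemeasurable)
  have h2 : ∫ v : Fin n → EuclideanSpace ℝ (Fin n), |ω (fun j => g (v j))|
      ∂(Measure.pi fun _ => μ) =
      ∫ i : Fin n → g.range, |ω (fun j => (i j : EuclideanSpace ℝ (Fin n)))|
        ∂((Measure.pi fun _ : Fin n => μ).map (fun v j => G (v j))) := by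
    rw [integral_map]
    · exact (measurable_pi_lambda _ fun j => hGm.comp (measurable_pi_apply j)).aemeasurable
    · exact (measurable_of_finite _).aestronglyMeasurable
  rw [h2, h1, integral_fintype (Integrable.of_finite), PP_eq_sum]
  refine Finset.sum_congr rfl fun i _ => ?_
  rw [smul_eq_mul, Measure.real, Measure.pi_singleton, ENNReal.toReal_prod]
  congr 1
  refine Finset.prod_congr rfl fun k _ => ?_
  rw [Measure.map_apply hGm (measurableSet_singleton _), Measure.real]
  congr 2
  ext v
  simp [hG, Subtype.ext_iff]

theorem integral_tendsto {n : ℕ} (μ : Measure (EuclideanSpace ℝ (Fin n)))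
    [IsProbabilityMeasure μ] (hμ : Integrable (fun y => ‖y‖) μ)
    (g : ℕ → SimpleFunc (EuclideanSpace ℝ (Fin n)) (EuclideanSpace ℝ (Fin n)))
    (hg1 : ∀ k v, ‖g k v‖ ≤ ‖v‖ + ‖v‖) (hg2 : ∀ v, Tendsto (fun k => g k v) atTop (𝓝 v))
    (ω : (EuclideanSpace ℝ (Fin n)) [⋀^Fin n]→ₗ[ℝ] ℝ) (hω : Continuous ω) :
    Tendsto (fun k => ∫ v : Fin n → EuclideanSpace ℝ (Fin n), |ω (fun j => g k (v j))|
      ∂(Measure.pi fun _ => μ)) atTop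
      (𝓝 (∫ v : Fin n → EuclideanSpace ℝ (Fin n), |ω v| ∂(Measure.pi fun _ => μ))) := by
  obtain ⟨C, hC, hb⟩ := ω.exists_bound_of_continuous hω
  refine tendsto_integral_of_dominated_convergence
    (fun v => C * ∏ j, (‖v j‖ + ‖v j‖)) ?_ ?_ ?_ ?_
  · intro k
    apply Measurable.aestronglyMeasurable
    refine (hω.measurable.comp ?_).abs
    exact measurable_pi_lambda _ fun j => (g k).measurable.comp (measurable_pi_apply j)
  · exact (Integrable.fintype_prod (fun _ => hμ.add hμ)).const_mul C
  · intro k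
    refine Eventually.of_forall fun v => ?_
    rw [Real.norm_eq_abs, abs_abs]
    refine (hb _).trans ?_
    refine mul_le_mul_of_nonneg_left ?_ hC.le
    exact Finset.prod_le_prod (fun _ _ => norm_nonneg _) fun j _ => hg1 k (v j)
  · refine Eventually.of_forall fun v => ?_
    refine ((hω.tendsto v).comp ?_).abs
    rw [tendsto_pi_nhds]
    exact fun j => hg2 (v j)

theorem isProb_mix {n : ℕ} (ν₁ ν₂ : Measure (EuclideanSpace ℝ (Fin n)))
    [IsProbabilityMeasure ν₁] [IsProbabilityMeasure ν₂] (t : ℝ) (ht : t ∈ Set.Icc (0 : ℝ) 1) :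
    IsProbabilityMeasure (ENNReal.ofReal (1 - t) • ν₁ + ENNReal.ofReal t • ν₂) := by
  constructor
  simp only [Measure.coe_add, Measure.coe_smul, Pi.add_apply, Pi.smul_apply, measure_univ,
    smul_eq_mul, mul_one]
  rw [← ENNReal.ofReal_add (sub_nonneg.mpr ht.2) ht.1]
  simp

/-- Mixing: the Vitale zonoid of a mixture law `(1-t)ν₁ + tν₂` is the Minkowski
combination `(1-t)Z(Y₁) + tZ(Y₂)`, and consequently `t ↦ (E|det M_{Y_t}|)^{1/n}`
is concave on `[0,1]`. -/
theorem zonoid_mixture_and_concavity {n : ℕ}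
    (ν₁ ν₂ : Measure (EuclideanSpace ℝ (Fin n)))
    [IsProbabilityMeasure ν₁] [IsProbabilityMeasure ν₂]
    (hmom₁ : Integrable (fun y => ‖y‖) ν₁) (hmom₂ : Integrable (fun y => ‖y‖) ν₂)
    (Z : ℝ → ConvexBody (EuclideanSpace ℝ (Fin n)))
    (Z₁ Z₂ : ConvexBody (EuclideanSpace ℝ (Fin n)))
    (hZ : ∀ t ∈ Set.Icc (0 : ℝ) 1, ∀ ξ,
      suppFn (Z t : Set (EuclideanSpace ℝ (Fin n))) ξ
        = ∫ y, suppFn (segment ℝ 0 y) ξ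
            ∂(ENNReal.ofReal (1 - t) • ν₁ + ENNReal.ofReal t • ν₂))
    (hZ₁ : ∀ ξ, suppFn (Z₁ : Set (EuclideanSpace ℝ (Fin n))) ξ
      = ∫ y, suppFn (segment ℝ 0 y) ξ ∂ν₁)
    (hZ₂ : ∀ ξ, suppFn (Z₂ : Set (EuclideanSpace ℝ (Fin n))) ξ
      = ∫ y, suppFn (segment ℝ 0 y) ξ ∂ν₂) :
    (∀ t ∈ Set.Icc (0 : ℝ) 1,
      (Z t : Set (EuclideanSpace ℝ (Fin n)))
        = (1 - t) • (Z₁ : Set (EuclideanSpace ℝ (Fin n)))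
          + t • (Z₂ : Set (EuclideanSpace ℝ (Fin n)))) ∧
    ConcaveOn ℝ (Set.Icc (0 : ℝ) 1) (fun t =>
      (∫ v : Fin n → EuclideanSpace ℝ (Fin n),
          |(Matrix.of fun i j => v j i : Matrix (Fin n) (Fin n) ℝ).det|
          ∂(Measure.pi fun _ => ENNReal.ofReal (1 - t) • ν₁ + ENNReal.ofReal t • ν₂))
        ^ ((1 : ℝ) / n)) := by
  constructor
  · intro t ht
    have ht1 : 0 ≤ 1 - t := sub_nonneg.mpr ht.2
    have hsupp : ∀ ξ, suppFn (Z t : Set (EuclideanSpace ℝ (Fin n))) ξ =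
        suppFn ((1 - t) • (Z₁ : Set (EuclideanSpace ℝ (Fin n)))
          + t • (Z₂ : Set (EuclideanSpace ℝ (Fin n)))) ξ := by
      intro ξ
      rw [suppFn_comb Z₁.isCompact Z₂.isCompact Z₁.nonempty Z₂.nonempty _ _ ht1 ht.1, hZ t ht,
        hZ₁, hZ₂, integral_add_measure
          ((suppFn_integrable ν₁ hmom₁ ξ).smul_measure ENNReal.ofReal_ne_top)
          ((suppFn_integrable ν₂ hmom₂ ξ).smul_measure ENNReal.ofReal_ne_top),
        integral_smul_measure, integral_smul_measure, ENNReal.toReal_ofReal ht1,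
        ENNReal.toReal_ofReal ht.1, smul_eq_mul, smul_eq_mul]
    have hc : IsCompact ((1 - t) • (Z₁ : Set (EuclideanSpace ℝ (Fin n)))
          + t • (Z₂ : Set (EuclideanSpace ℝ (Fin n)))) :=
      (Z₁.isCompact.smul (1 - t)).add (Z₂.isCompact.smul t)
    have hcv : Convex ℝ ((1 - t) • (Z₁ : Set (EuclideanSpace ℝ (Fin n)))
          + t • (Z₂ : Set (EuclideanSpace ℝ (Fin n)))) :=
      (Z₁.convex.smul (1 - t)).add (Z₂.convex.smul t)
    have hne : ((1 - t) • (Z₁ : Set (EuclideanSpace ℝ (Fin n)))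
          + t • (Z₂ : Set (EuclideanSpace ℝ (Fin n)))).Nonempty :=
      (Z₁.nonempty.smul_set).add (Z₂.nonempty.smul_set)
    exact Set.Subset.antisymm
      (subset_of_suppFn (Z t).isCompact hc hcv hne fun ξ => (hsupp ξ).le)
      (subset_of_suppFn hc (Z t).isCompact (Z t).convex (Z t).nonempty fun ξ => (hsupp ξ).ge)
  · rcases Nat.eq_zero_or_pos n with hn | hn
    · subst hn
      simp only [Nat.cast_zero, div_zero, Real.rpow_zero]
      exact concaveOn_const _ (convex_Icc _ _)
    obtain ⟨ω, hωc, hω⟩ : ∃ ω : (EuclideanSpace ℝ (Fin n)) [⋀^Fin n]→ₗ[ℝ] ℝ, Continuous ω ∧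
        ∀ v : Fin n → EuclideanSpace ℝ (Fin n),
          (Matrix.of fun i j => v j i : Matrix (Fin n) (Fin n) ℝ).det = ω v := by
      have h : ∀ v : Fin n → EuclideanSpace ℝ (Fin n),
          (Matrix.of fun i j => v j i : Matrix (Fin n) (Fin n) ℝ).det =
            (EuclideanSpace.basisFun (Fin n) ℝ).toBasis.det v := by
        intro v
        rw [Module.Basis.det_apply]
        congr 1
      refine ⟨(EuclideanSpace.basisFun (Fin n) ℝ).toBasis.det, ?_, h⟩
      have : (fun v : Fin n → EuclideanSpace ℝ (Fin n) =>
          (EuclideanSpace.basisFun (Fin n) ℝ).toBasis.det v) = fun v =>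
          (Matrix.of fun i j => v j i : Matrix (Fin n) (Fin n) ℝ).det := by
        ext v; rw [h]
      change Continuous (fun v : Fin n → EuclideanSpace ℝ (Fin n) =>
          (EuclideanSpace.basisFun (Fin n) ℝ).toBasis.det v)
      rw [this]
      refine Continuous.matrix_det ?_
      refine continuous_matrix fun i j => ?_
      simp only [Matrix.of_apply]
      fun_prop
    simp only [hω]
    set g : ℕ → SimpleFunc (EuclideanSpace ℝ (Fin n)) (EuclideanSpace ℝ (Fin n)) := fun k =>
      SimpleFunc.approxOn id measurable_id Set.univ 0 (Set.mem_univ _) k with hg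
    have hg1 : ∀ k v, ‖g k v‖ ≤ ‖v‖ + ‖v‖ := fun k v =>
      SimpleFunc.norm_approxOn_zero_le measurable_id (Set.mem_univ _) v k
    have hg2 : ∀ v, Tendsto (fun k => g k v) atTop (𝓝 v) := fun v =>
      SimpleFunc.tendsto_approxOn measurable_id (Set.mem_univ _) (by simp)
    refine concaveOn_of_tendsto (F := fun k t =>
      (∫ v : Fin n → EuclideanSpace ℝ (Fin n), |ω (fun j => g k (v j))|
        ∂(Measure.pi fun _ => ENNReal.ofReal (1 - t) • ν₁ + ENNReal.ofReal t • ν₂))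
        ^ ((1 : ℝ) / n)) (convex_Icc _ _) ?_ ?_
    · intro k
      obtain ⟨m, rfl⟩ : ∃ m, n = m + 1 := ⟨n - 1, by omega⟩
      refine (finite_concave m (by simp) ω
        (fun i : (g k).range => (i : EuclideanSpace ℝ (Fin (m + 1))))
        (fun i => ν₁.real (g k ⁻¹' {(i : EuclideanSpace ℝ (Fin (m + 1)))}))
        (fun i => ν₂.real (g k ⁻¹' {(i : EuclideanSpace ℝ (Fin (m + 1)))}))
        (fun i => measureReal_nonneg) (fun i => measureReal_nonneg)).congr ?_
      intro t ht
      have := isProb_mix ν₁ ν₂ t ht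
      simp only
      rw [integral_simple_eq_PP]
      congr 2
      ext i
      rw [Measure.real, Measure.real, Measure.real, Measure.add_apply, Measure.smul_apply,
        Measure.smul_apply, smul_eq_mul, smul_eq_mul, ENNReal.toReal_add
          (ENNReal.mul_ne_top ENNReal.ofReal_ne_top (measure_ne_top _ _))
          (ENNReal.mul_ne_top ENNReal.ofReal_ne_top (measure_ne_top _ _)),
        ENNReal.toReal_mul, ENNReal.toReal_mul, ENNReal.toReal_ofReal (sub_nonneg.mpr ht.2),
        ENNReal.toReal_ofReal ht.1]
    · intro t ht
      have := isProb_mix ν₁ ν₂ t ht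
      refine Tendsto.rpow_const ?_ (Or.inr (by positivity))
      exact integral_tendsto _ ((hmom₁.smul_measure ENNReal.ofReal_ne_top).add_measure
        (hmom₂.smul_measure ENNReal.ofReal_ne_top)) g hg1 hg2 ω hωc
end

section
/- The volume of the zonotope Z = [0,v_1] + ⋯ + [0,v_N] in ℝ^n is |Z| = Σ |det(v_{i_1},…,v_{i_n})|, the sum over all 1 ≤ i_1 < ⋯ < i_n ≤ N of the absolute determinants of the n×n matrices with the chosen columns. -/
open MeasureTheory Metric Set Filter
open scoped RealInnerProductSpace NNReal ENNReal Pointwise Topology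

/-- The determinant sum. -/
noncomputable def zdet {n N : ℕ} (v : Fin N → (Fin n → ℝ)) : ℝ :=
  ∑ σ ∈ Finset.univ.filter (fun σ : Fin n → Fin N => StrictMono σ),
    |(Matrix.of fun i j => v (σ j) i : Matrix (Fin n) (Fin n) ℝ).det|

theorem zdet_nonneg {n N : ℕ} (v : Fin N → (Fin n → ℝ)) : 0 ≤ zdet v :=
  Finset.sum_nonneg fun _ _ => abs_nonneg _

/-- The zonotope. -/
def zono {n N : ℕ} (v : Fin N → (Fin n → ℝ)) : Set (Fin n → ℝ) :=
  ∑ i, segment ℝ 0 (v i)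

theorem strictMono_cons_iff {n N : ℕ} (τ : Fin n → Fin N) :
    StrictMono (Fin.cons 0 (fun j => (τ j).succ) : Fin (n + 1) → Fin (N + 1)) ↔ StrictMono τ := by
  constructor
  · intro h i j hij
    have := h (Fin.succ_lt_succ_iff.2 hij)
    simpa using this
  · intro h i j hij
    induction i using Fin.cases with
    | zero =>
      induction j using Fin.cases with
      | zero => exact absurd hij (lt_irrefl _)
      | succ j => simp
    | succ i =>
      induction j using Fin.cases with
      | zero => exact absurd hij (by simp)
      | succ j => simpa using h (Fin.succ_lt_succ_iff.1 hij)

theorem zdet_succ {n N : ℕ} (v : Fin (N + 1) → (Fin (n + 1) → ℝ)) :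
    zdet v = zdet (fun i => v i.succ) +
      ∑ τ ∈ Finset.univ.filter (fun τ : Fin n → Fin N => StrictMono τ),
        |(Matrix.of fun i j => v ((Fin.cons 0 (fun j => (τ j).succ) :
          Fin (n + 1) → Fin (N + 1)) j) i : Matrix (Fin (n + 1)) (Fin (n + 1)) ℝ).det| := by
  unfold zdet
  rw [← Finset.sum_filter_add_sum_filter_not _ (fun σ : Fin (n + 1) → Fin (N + 1) => σ 0 ≠ 0)]
  congr 1
  · symm
    refine Finset.sum_bij (fun τ _ => fun j => (τ j).succ) ?_ ?_ ?_ ?_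
    · intro τ hτ
      simp only [Finset.mem_filter, Finset.mem_univ, true_and] at hτ ⊢
      exact ⟨fun i j hij => Fin.succ_lt_succ_iff.2 (hτ hij), Fin.succ_ne_zero _⟩
    · intro a _ b _ h
      funext j
      exact Fin.succ_injective _ (congrFun h j)
    · intro σ hσ
      simp only [Finset.mem_filter, Finset.mem_univ, true_and] at hσ
      have hne : ∀ j, σ j ≠ 0 := fun j h => by
        have h1 := hσ.1.monotone (Fin.zero_le j)
        rw [h] at h1
        exact hσ.2 (Fin.le_zero_iff.1 h1)
      refine ⟨fun j => (σ j).pred (hne j), ?_, ?_⟩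
      · simp only [Finset.mem_filter, Finset.mem_univ, true_and]
        intro i j hij
        exact Fin.pred_lt_pred_iff.2 (hσ.1 hij)
      · funext j; simp
    · intro τ _; rfl
  · symm
    refine Finset.sum_bij (fun τ _ => Fin.cons 0 (fun j => (τ j).succ)) ?_ ?_ ?_ ?_
    · intro τ hτ
      simp only [Finset.mem_filter, Finset.mem_univ, true_and] at hτ ⊢
      exact ⟨(strictMono_cons_iff τ).2 hτ, by simp⟩
    · intro a _ b _ h
      funext j
      have := congrFun h j.succ
      simpa using this
    · intro σ hσ
      simp only [Finset.mem_filter, Finset.mem_univ, true_and, not_not] at hσ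
      have hne : ∀ j : Fin n, σ j.succ ≠ 0 := fun j h => by
        have h1 := hσ.1 (Fin.succ_pos j)
        rw [h] at h1
        exact absurd h1 (by simp)
      have he : (Fin.cons 0 (fun j => ((σ j.succ).pred (hne j)).succ) : Fin (n + 1) → Fin (N + 1))
          = σ := by
        funext j
        induction j using Fin.cases with
        | zero => simp [hσ.2]
        | succ j => simp
      refine ⟨fun j => (σ j.succ).pred (hne j), ?_, he⟩
      simp only [Finset.mem_filter, Finset.mem_univ, true_and]
      rw [← strictMono_cons_iff, he]
      exact hσ.1
    · intro τ _; rfl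

theorem zdet_map {n N : ℕ} (v : Fin N → (Fin n → ℝ)) (A : (Fin n → ℝ) →ₗ[ℝ] (Fin n → ℝ)) :
    zdet (fun i => A (v i)) = |LinearMap.det A| * zdet v := by
  unfold zdet
  rw [Finset.mul_sum]
  refine Finset.sum_congr rfl fun σ _ => ?_
  rw [← LinearMap.det_toMatrix', ← abs_mul, ← Matrix.det_mul]
  congr 2
  ext i j
  have := congrFun (LinearMap.toMatrix'_mulVec A (v (σ j))) i
  simp only [Matrix.of_apply, Matrix.mul_apply]
  rw [← this]
  rfl

theorem zono_map {n m N : ℕ} (v : Fin N → (Fin n → ℝ)) (A : (Fin n → ℝ) →ₗ[ℝ] (Fin m → ℝ)) :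
    A '' zono v = zono (fun i => A (v i)) := by
  unfold zono
  rw [Set.image_finsetSum]
  refine Finset.sum_congr rfl fun i _ => ?_
  have := image_segment ℝ A.toAffineMap 0 (v i)
  simpa using this

theorem zono_convex {n N : ℕ} (v : Fin N → (Fin n → ℝ)) : Convex ℝ (zono v) :=
  convex_sum _ fun _ _ => convex_segment _ _

theorem isCompact_zono {n N : ℕ} (v : Fin N → (Fin n → ℝ)) : IsCompact (zono v) := by
  unfold zono
  refine Finset.sum_induction _ IsCompact (fun _ _ h1 h2 => h1.add h2) isCompact_singleton ?_
  intro i _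
  rw [segment_eq_image]
  exact isCompact_Icc.image (by fun_prop)

theorem zono_succ {n N : ℕ} (v : Fin (N + 1) → (Fin n → ℝ)) :
    zono v = segment ℝ 0 (v 0) + zono (fun i => v i.succ) := by
  unfold zono
  rw [Fin.sum_univ_succ]

theorem vol_section (S : Set ℝ) (hS : IsCompact S) (hc : Convex ℝ S) (hne : S.Nonempty) :
    volume (Icc (0 : ℝ) 1 + S) = volume S + 1 := by
  have h := eq_Icc_of_connected_compact ⟨hne, hc.isPreconnected⟩ hS
  set a := sInf S
  set b := sSup S
  have hab : a ≤ b := by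
    rw [h] at hne; exact nonempty_Icc.1 hne
  rw [h, Set.Icc_add_Icc zero_le_one hab, Real.volume_Icc, Real.volume_Icc, ← ENNReal.ofReal_one,
    ← ENNReal.ofReal_add (by linarith) zero_le_one]
  congr 1; ring

/-- Slicing along coordinate `0`. -/
theorem volume_slice {n : ℕ} (S : Set (Fin (n + 1) → ℝ)) (hS : IsCompact S) :
    volume S = ∫⁻ y : Fin n → ℝ, volume {t : ℝ | (Fin.cons t y : Fin (n + 1) → ℝ) ∈ S} := by
  have h := (volume_preserving_piFinSuccAbove (fun _ : Fin (n + 1) => ℝ) 0).symm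
  rw [← h.measure_preimage hS.measurableSet.nullMeasurableSet]
  rw [Measure.volume_eq_prod, Measure.prod_apply_symm]
  · refine lintegral_congr fun y => ?_
    congr 1
    ext t
    simp [MeasurableEquiv.piFinSuccAbove, Fin.insertNthEquiv]
  · exact h.measurable hS.measurableSet

theorem volume_add_segment {n : ℕ} (K : Set (Fin (n + 1) → ℝ)) (hK : IsCompact K)
    (hc : Convex ℝ K) :
    volume (segment ℝ 0 (Pi.single 0 1) + K) = volume K +
      volume ((LinearMap.funLeft ℝ ℝ (Fin.succ : Fin n → Fin (n + 1))) '' K) := by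
  have hseg : IsCompact (segment ℝ 0 (Pi.single 0 1 : Fin (n + 1) → ℝ)) := by
    rw [segment_eq_image]
    exact isCompact_Icc.image (by fun_prop)
  have hT : MeasurableSet ((LinearMap.funLeft ℝ ℝ (Fin.succ : Fin n → Fin (n + 1))) '' K) :=
    (hK.image (LinearMap.continuous_of_finiteDimensional _)).measurableSet
  rw [volume_slice _ (hseg.add hK), volume_slice _ hK, ← lintegral_indicator_one hT,
    ← lintegral_add_right _ (measurable_one.indicator hT)]
  refine lintegral_congr fun y => ?_
  have hcons : ∀ (s t : ℝ), (Fin.cons (s + t) y : Fin (n + 1) → ℝ) =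
      s • (Pi.single 0 1 : Fin (n + 1) → ℝ) + Fin.cons t y := by
    intro s t
    funext j
    induction j using Fin.cases with
    | zero => simp
    | succ j => simp
  have hsec : {t : ℝ | (Fin.cons t y : Fin (n + 1) → ℝ) ∈ segment ℝ 0 (Pi.single 0 1) + K} =
      Icc (0 : ℝ) 1 + {t : ℝ | (Fin.cons t y : Fin (n + 1) → ℝ) ∈ K} := by
    ext t
    simp only [Set.mem_add, Set.mem_ofPred_eq, segment_eq_image]
    constructor
    · rintro ⟨_, ⟨s, hs, rfl⟩, k, hk, h⟩
      refine ⟨s, hs, t - s, ?_, by ring⟩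
      have h2 := hcons s (t - s)
      rw [add_sub_cancel, ← h] at h2
      simp only [smul_zero, zero_add] at h2
      rw [← add_left_cancel h2]
      exact hk
    · rintro ⟨s, hs, u, hu, rfl⟩
      exact ⟨_, ⟨s, hs, rfl⟩, _, hu, by simp [hcons]⟩
  rw [hsec]
  by_cases hy : y ∈ (LinearMap.funLeft ℝ ℝ (Fin.succ : Fin n → Fin (n + 1))) '' K
  · rw [Set.indicator_of_mem hy, Pi.one_apply]
    apply vol_section
    · refine (hK.image (continuous_apply (0 : Fin (n + 1)))).of_isClosed_subset ?_ ?_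
      · exact hK.isClosed.preimage (by fun_prop)
      · intro t ht
        exact ⟨_, ht, by simp⟩
    · intro a ha b hb p q hp hq hpq
      have := hc ha hb hp hq hpq
      simp only [Set.mem_ofPred_eq]
      convert this using 1
      funext j
      induction j using Fin.cases with
      | zero => simp
      | succ j => simp [← add_mul, hpq]
    · obtain ⟨k, hk, rfl⟩ := hy
      refine ⟨k 0, ?_⟩
      simp only [Set.mem_ofPred_eq]
      convert hk using 1
      funext j
      induction j using Fin.cases with
      | zero => simp
      | succ j => simp [LinearMap.funLeft_apply]
  · rw [Set.indicator_of_notMem hy, add_zero]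
    have : {t : ℝ | (Fin.cons t y : Fin (n + 1) → ℝ) ∈ K} = ∅ := by
      rw [Set.eq_empty_iff_forall_notMem]
      intro t ht
      exact hy ⟨_, ht, by funext j; simp [LinearMap.funLeft_apply]⟩
    rw [this, Set.add_empty]

theorem zono_zero_dim {N : ℕ} (v : Fin N → (Fin 0 → ℝ)) :
    volume (zono v) = ENNReal.ofReal (zdet v) := by
  have h1 : (zono v) = {0} := by
    have hne : (zono v).Nonempty := by
      refine ⟨∑ _i : Fin N, 0, ?_⟩
      exact Set.finsetSum_mem_finsetSum _ _ _ fun i _ => left_mem_segment _ _ _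
    obtain ⟨x, hx⟩ := hne
    ext y
    rw [Subsingleton.elim y x]
    exact ⟨fun _ => Subsingleton.elim _ _, fun _ => hx⟩
  have h2 : zdet v = 1 := by
    unfold zdet
    rw [Finset.filter_true_of_mem (fun σ _ i => i.elim0)]
    simp
  rw [h1, h2]
  rw [show ({0} : Set (Fin 0 → ℝ)) = Set.pi Set.univ (fun _ => Set.univ) from by
    ext y; exact ⟨fun _ i => i.elim0, fun _ => Subsingleton.elim _ _⟩, volume_pi_pi]
  simp

theorem zono_volume (N : ℕ) : ∀ {n : ℕ} (v : Fin N → (Fin n → ℝ)),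
    volume (zono v) = ENNReal.ofReal (zdet v) := by
  induction N with
  | zero =>
    intro n v
    cases n with
    | zero => exact zono_zero_dim v
    | succ n =>
      have : zdet v = 0 := by
        unfold zdet
        refine Finset.sum_eq_zero fun σ _ => (σ 0).elim0
      rw [this]
      simp [zono, ← Set.singleton_zero]
  | succ N ih =>
    intro n v
    cases n with
    | zero => exact zono_zero_dim v
    | succ n =>
      by_cases h0 : v 0 = 0
      · rw [zono_succ, h0, segment_same, Set.singleton_zero, zero_add, ih, zdet_succ,
          Finset.sum_eq_zero, add_zero]
        intro τ _
        rw [abs_eq_zero]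
        refine Matrix.det_eq_zero_of_column_eq_zero 0 fun i => ?_
        simp [h0]
      · have key : ∀ w : Fin (N + 1) → (Fin (n + 1) → ℝ), w 0 = Pi.single 0 1 →
            volume (zono w) = ENNReal.ofReal (zdet w) := by
          intro w hw
          rw [zono_succ, hw, volume_add_segment _ (isCompact_zono _) (zono_convex _), zono_map,
            ih, ih, ← ENNReal.ofReal_add (zdet_nonneg _) (zdet_nonneg _), zdet_succ]
          congr 2
          unfold zdet
          refine Finset.sum_congr rfl fun τ _ => ?_
          rw [Matrix.det_succ_column_zero, Finset.sum_eq_single 0]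
          · simp only [Matrix.of_apply, Fin.cons_zero, hw, Pi.single_eq_same, Fin.val_zero,
              pow_zero, one_mul]
            rfl
          · intro i _ hi
            simp [hw, hi]
          · simp
        obtain ⟨A, hA⟩ := SeparatingDual.exists_continuousLinearEquiv_apply_eq (R := ℝ) h0
          (y := (Pi.single 0 1 : Fin (n + 1) → ℝ)) (by simp)
        have hk := key (fun i => (A : (Fin (n + 1) → ℝ) →ₗ[ℝ] (Fin (n + 1) → ℝ)) (v i)) hA
        rw [← zono_map, zdet_map, Measure.addHaar_image_linearMap,
          ENNReal.ofReal_mul (abs_nonneg _)] at hk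
        refine (ENNReal.mul_right_inj ?_ ENNReal.ofReal_ne_top).1 hk
        have : LinearMap.det (A : (Fin (n + 1) → ℝ) →ₗ[ℝ] (Fin (n + 1) → ℝ)) ≠ 0 :=
          (LinearEquiv.isUnit_det' A.toLinearEquiv).ne_zero
        simpa using this

/-- The volume of the zonotope `Z = [0,v₁] + ⋯ + [0,v_N]` in `ℝⁿ` equals the sum of
`|det(v_{i₁},…,v_{i_n})|` over all `1 ≤ i₁ < ⋯ < i_n ≤ N` (indexed here by strictly
monotone maps `σ : Fin n → Fin N`). -/
theorem zonotope_volume {n N : ℕ} (v : Fin N → EuclideanSpace ℝ (Fin n)) :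
    volume (∑ i, segment ℝ (0 : EuclideanSpace ℝ (Fin n)) (v i))
      = ENNReal.ofReal (∑ σ ∈ Finset.univ.filter (fun σ : Fin n → Fin N => StrictMono σ),
          |(Matrix.of fun i j => v (σ j) i : Matrix (Fin n) (Fin n) ℝ).det|) := by
  have h := zono_volume N (fun i => (v i).ofLp)
  have himg : (WithLp.ofLp : EuclideanSpace ℝ (Fin n) → (Fin n → ℝ)) ''
      (∑ i, segment ℝ (0 : EuclideanSpace ℝ (Fin n)) (v i)) = zono (fun i => (v i).ofLp) := by
    change (WithLp.linearEquiv 2 ℝ (Fin n → ℝ)) '' _ = _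
    rw [Set.image_finsetSum]
    unfold zono
    refine Finset.sum_congr rfl fun i _ => ?_
    have := image_segment ℝ
      (WithLp.linearEquiv 2 ℝ (Fin n → ℝ)).toLinearMap.toAffineMap 0 (v i)
    simpa using this
  have hpre : (∑ i, segment ℝ (0 : EuclideanSpace ℝ (Fin n)) (v i)) =
      (WithLp.ofLp : EuclideanSpace ℝ (Fin n) → (Fin n → ℝ)) ⁻¹' zono (fun i => (v i).ofLp) := by
    rw [← himg, Set.preimage_image_eq _ (WithLp.ofLp_injective 2)]
  rw [hpre, (PiLp.volume_preserving_ofLp (Fin n)).measure_preimage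
    (isCompact_zono _).measurableSet.nullMeasurableSet, h]
  rfl
end
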